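/- With the above setup, assume additionally that the tuples (A₁¹,…,A_{p+1}¹) and (A₁²,…,A_{p+1}²) are irreducible and that ξ := dim_ℂ R − dim_ℂ Q ≥ 2 (where R and Q are as above, so ξ = dim Ext¹(P₁,P₂)). Then there exists an irreducible (p+1)-tuple (B₁,…,B_{p+1}) of (m₁+m₂)×(m₁+m₂) complex matrices with B₁+…+B_{p+1} = 0 and with each B_j conjugate to the block-diagonal matrix diag(A_j¹, A_j²); i.e., the semidirect sum of P₁ and P₂ can be deformed into an irreducible representation without changing the conjugacy classes of the matrices. -/

import Mathlib

open Matrix Polynomial BigOperators Finset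

noncomputable section

def commSubmodule (N : Type*) [Fintype N] (A : Matrix N N ℂ) :
    Submodule ℂ (Matrix N N ℂ) where
  carrier := {X | X * A = A * X}
  add_mem' := by
    intro X Y hX hY
    simp only [Set.mem_setOf_eq] at *
    rw [Matrix.add_mul, Matrix.mul_add, hX, hY]
  zero_mem' := by
    simp only [Set.mem_setOf_eq, Matrix.zero_mul, Matrix.mul_zero]
  smul_mem' := by
    intro c X hX
    simp only [Set.mem_setOf_eq] at *
    rw [Matrix.smul_mul, Matrix.mul_smul, hX]

/-- `d` of a matrix: `n² - dim of centralizer`. -/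
def dQ {N : Type*} [Fintype N] (A : Matrix N N ℂ) : ℕ :=
  Fintype.card N ^ 2 - Module.finrank ℂ (commSubmodule N A)

/-- `r` of a matrix: the minimum over `μ` of `rank (A - μ • 1)`. -/
def rQ {N : Type*} [Fintype N] [DecidableEq N] (A : Matrix N N ℂ) : ℕ :=
  sInf {k | ∃ μ : ℂ, (A - μ • (1 : Matrix N N ℂ)).rank = k}

/-- The conjugacy class of a matrix under `GL(n, ℂ)`-conjugation. -/
def conjClass {n : ℕ} (A : Matrix (Fin n) (Fin n) ℂ) : Set (Matrix (Fin n) (Fin n) ℂ) :=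
  {B | ∃ g : (Matrix (Fin n) (Fin n) ℂ)ˣ, B = (g : Matrix (Fin n) (Fin n) ℂ) * A * (↑g⁻¹ : Matrix (Fin n) (Fin n) ℂ)}

/-- The conjugacy class of an element of `GL(n, ℂ)`. -/
def conjClassU {n : ℕ} (M : (Matrix (Fin n) (Fin n) ℂ)ˣ) : Set ((Matrix (Fin n) (Fin n) ℂ)ˣ) :=
  {N | ∃ g, N = g * M * g⁻¹}

/-- Irreducibility of a tuple: no common invariant subspace other than `⊥` and `⊤`. -/
def IrredTuple {N : Type*} [Fintype N] {q : ℕ} (A : Fin q → Matrix N N ℂ) : Prop :=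
  ∀ U : Submodule ℂ (N → ℂ), (∀ j, ∀ v ∈ U, (A j).mulVec v ∈ U) → U = ⊥ ∨ U = ⊤

/-- Trivial centralizer of a tuple: only scalar matrices commute with all members. -/
def TrivCent {N : Type*} [Fintype N] [DecidableEq N] {q : ℕ} (A : Fin q → Matrix N N ℂ) : Prop :=
  ∀ X : Matrix N N ℂ, (∀ j, X * A j = A j * X) → ∃ κ : ℂ, X = κ • (1 : Matrix N N ℂ)

/-- A matrix has `n` distinct eigenvalues. -/
def HasDistinctEigen {n : ℕ} (A : Matrix (Fin n) (Fin n) ℂ) : Prop :=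
  ∃ ev : Fin n → ℂ, Function.Injective ev ∧
    A.charpoly = ∏ i, (Polynomial.X - Polynomial.C (ev i))

/-- The variety 𝒱(c₁,…,c_{q}) where `c_j` is the conjugacy class of `A j`. -/
def Vset {n q : ℕ} (A : Fin q → Matrix (Fin n) (Fin n) ℂ) :
    Set (Fin q → Matrix (Fin n) (Fin n) ℂ) :=
  {B | (∀ j, B j ∈ conjClass (A j)) ∧ ∑ j, B j = 0}

/-- The variety 𝒲(C₁,…,C_q) where `C_j` is the conjugacy class of `M j` in `GL(n,ℂ)`. -/
def Wset {n q : ℕ} (M : Fin q → (Matrix (Fin n) (Fin n) ℂ)ˣ) :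
    Set (Fin q → (Matrix (Fin n) (Fin n) ℂ)ˣ) :=
  {B | (∀ j, B j ∈ conjClassU (M j)) ∧ (List.ofFn B).prod = 1}

/-- For square matrices `A`, `B`, the linear map `X ↦ A * X - X * B` on rectangular
matrices. -/
def commMap {m₁ m₂ : ℕ} (A : Matrix (Fin m₁) (Fin m₁) ℂ) (B : Matrix (Fin m₂) (Fin m₂) ℂ) :
    Matrix (Fin m₁) (Fin m₂) ℂ →ₗ[ℂ] Matrix (Fin m₁) (Fin m₂) ℂ where
  toFun X := A * X - X * B
  map_add' X Y := by
    show A * (X + Y) - (X + Y) * B = (A * X - X * B) + (A * Y - Y * B)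
    rw [Matrix.mul_add, Matrix.add_mul]; abel
  map_smul' c X := by
    show A * (c • X) - (c • X) * B = c • (A * X - X * B)
    rw [Matrix.mul_smul, Matrix.smul_mul, smul_sub]

/-- Summation of the components, as a linear map. -/
def sumMap (q : ℕ) (M : Type*) [AddCommGroup M] [Module ℂ M] :
    (Fin q → M) →ₗ[ℂ] M :=
  ∑ j : Fin q, LinearMap.proj j

/-- The map `(X_j)_j ↦ (A¹_j X_j - X_j A²_j)_j`. -/
def psiMap {q m₁ m₂ : ℕ} (A1 : Fin q → Matrix (Fin m₁) (Fin m₁) ℂ)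
    (A2 : Fin q → Matrix (Fin m₂) (Fin m₂) ℂ) :
    (Fin q → Matrix (Fin m₁) (Fin m₂) ℂ) →ₗ[ℂ] (Fin q → Matrix (Fin m₁) (Fin m₂) ℂ) :=
  LinearMap.pi (fun j => commMap (A1 j) (A2 j) ∘ₗ LinearMap.proj j)

/-- The space `R = {(A¹_j X_j - X_j A²_j)_j : Σ_j (A¹_j X_j - X_j A²_j) = 0}`. -/
def Rsub {q m₁ m₂ : ℕ} (A1 : Fin q → Matrix (Fin m₁) (Fin m₁) ℂ)
    (A2 : Fin q → Matrix (Fin m₂) (Fin m₂) ℂ) :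
    Submodule ℂ (Fin q → Matrix (Fin m₁) (Fin m₂) ℂ) :=
  Submodule.map (psiMap A1 A2)
    (LinearMap.ker ((sumMap q (Matrix (Fin m₁) (Fin m₂) ℂ)) ∘ₗ psiMap A1 A2))

/-- The space `Q = {(A¹_j X - X A²_j)_j : X}`. -/
def Qsub {q m₁ m₂ : ℕ} (A1 : Fin q → Matrix (Fin m₁) (Fin m₁) ℂ)
    (A2 : Fin q → Matrix (Fin m₂) (Fin m₂) ℂ) :
    Submodule ℂ (Fin q → Matrix (Fin m₁) (Fin m₂) ℂ) :=
  LinearMap.range (LinearMap.pi (fun j => commMap (A1 j) (A2 j)))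

theorem Matrix.eq_zero_of_mul_eq_mul_of_isCoprime_charpoly {n m : Type*} [Fintype n] [DecidableEq n]
    [Fintype m] [DecidableEq m] {A : Matrix n n ℂ} {D : Matrix m m ℂ}
    (h : IsCoprime A.charpoly D.charpoly) {Y : Matrix n m ℂ} (hY : A * Y = Y * D) : Y = 0 := by
  have key : ∀ f : ℂ[X], aeval A f * Y = Y * aeval D f := by
    intro f
    induction f using Polynomial.induction_on' with
    | add f g hf hg => simp only [map_add, Matrix.add_mul, Matrix.mul_add, hf, hg]
    | monomial k c =>
      have hk : A ^ k * Y = Y * D ^ k := by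
        induction k with
        | zero => simp
        | succ k ih =>
          rw [pow_succ, Matrix.mul_assoc, hY, ← Matrix.mul_assoc, ih, Matrix.mul_assoc, pow_succ]
      simp only [aeval_monomial, Algebra.algebraMap_eq_smul_one, smul_mul_assoc, one_mul,
        Matrix.smul_mul, Matrix.mul_smul, hk]
  obtain ⟨u, v, huv⟩ := h
  have h1 : aeval A v * aeval A D.charpoly = 1 := by
    have := congrArg (aeval A) huv
    simpa [Matrix.aeval_self_charpoly] using this
  calc Y = (aeval A v * aeval A D.charpoly) * Y := by rw [h1, Matrix.one_mul]
    _ = 0 := by rw [Matrix.mul_assoc, key, Matrix.aeval_self_charpoly]; simp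

theorem Matrix.exists_trace_mul_eq_dual {n m : Type*} [Fintype n] [DecidableEq n]
    [Fintype m] [DecidableEq m] (φ : Module.Dual ℂ (Matrix n m ℂ)) :
    ∃ Z : Matrix m n ℂ, ∀ Y, φ Y = (Y * Z).trace := by
  refine ⟨Matrix.of fun j i => φ (Matrix.single i j 1), fun Y => ?_⟩
  conv_lhs => rw [Matrix.matrix_eq_sum_single Y]
  simp only [map_sum, Matrix.trace, Matrix.diag, Matrix.mul_apply, Matrix.of_apply]
  refine Finset.sum_congr rfl fun i _ => Finset.sum_congr rfl fun j _ => ?_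
  rw [← mul_one (Y i j), ← smul_eq_mul, ← Matrix.smul_single, map_smul, smul_eq_mul, smul_eq_mul,
    mul_one]

theorem Matrix.eq_zero_of_forall_trace_mul_eq_zero {n m : Type*} [Fintype n] [DecidableEq n]
    [Fintype m] [DecidableEq m] {Z : Matrix m n ℂ}
    (h : ∀ Y : Matrix n m ℂ, (Y * Z).trace = 0) : Z = 0 := by
  ext j i
  simpa [Matrix.trace_single_mul] using h (Matrix.single i j 1)

/-- The trace pairing of rectangular matrices, as an isomorphism with the dual space. -/
def tracePairing (m₁ m₂ : ℕ) : Matrix (Fin m₂) (Fin m₁) ℂ ≃ₗ[ℂ]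
    Module.Dual ℂ (Matrix (Fin m₁) (Fin m₂) ℂ) :=
  LinearEquiv.ofBijective
    (LinearMap.mk₂ ℂ (fun Z Y => (Y * Z).trace)
      (fun Z Z' Y => by rw [Matrix.mul_add, Matrix.trace_add])
      (fun c Z Y => by rw [Matrix.mul_smul, Matrix.trace_smul])
      (fun Z Y Y' => by rw [Matrix.add_mul, Matrix.trace_add])
      (fun c Z Y => by rw [Matrix.smul_mul, Matrix.trace_smul]))
    ⟨by
      rw [← LinearMap.ker_eq_bot, LinearMap.ker_eq_bot']
      intro Z hZ
      exact Matrix.eq_zero_of_forall_trace_mul_eq_zero fun Y => LinearMap.congr_fun hZ Y,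
    fun φ => by
      obtain ⟨Z, hZ⟩ := Matrix.exists_trace_mul_eq_dual φ
      exact ⟨Z, LinearMap.ext fun Y => (hZ Y).symm⟩⟩

theorem tracePairing_apply {m₁ m₂ : ℕ} (Z : Matrix (Fin m₂) (Fin m₁) ℂ)
    (Y : Matrix (Fin m₁) (Fin m₂) ℂ) : tracePairing m₁ m₂ Z Y = (Y * Z).trace := rfl

theorem commMap_apply {m₁ m₂ : ℕ} (A : Matrix (Fin m₁) (Fin m₁) ℂ) (B : Matrix (Fin m₂) (Fin m₂) ℂ)
    (Y : Matrix (Fin m₁) (Fin m₂) ℂ) : commMap A B Y = A * Y - Y * B := rfl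

theorem trace_commMap_mul {m₁ m₂ : ℕ} (A : Matrix (Fin m₁) (Fin m₁) ℂ)
    (B : Matrix (Fin m₂) (Fin m₂) ℂ) (Y : Matrix (Fin m₁) (Fin m₂) ℂ)
    (Z : Matrix (Fin m₂) (Fin m₁) ℂ) :
    (commMap A B Y * Z).trace = -(Y * commMap B A Z).trace := by
  simp only [commMap_apply, Matrix.sub_mul, Matrix.mul_sub, Matrix.trace_sub]
  rw [Matrix.mul_assoc A, Matrix.trace_mul_comm A, Matrix.mul_assoc, Matrix.mul_assoc]
  ring

theorem finrank_range_commMap_comm {m₁ m₂ : ℕ} (A : Matrix (Fin m₁) (Fin m₁) ℂ)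
    (B : Matrix (Fin m₂) (Fin m₂) ℂ) :
    Module.finrank ℂ (LinearMap.range (commMap B A)) =
      Module.finrank ℂ (LinearMap.range (commMap A B)) := by
  have h : (tracePairing m₁ m₂).toLinearMap ∘ₗ commMap B A =
      (commMap A B).dualMap ∘ₗ (-(tracePairing m₁ m₂).toLinearMap) := by
    ext1 Z
    ext1 Y
    simp [tracePairing_apply, trace_commMap_mul]
  have hr : LinearMap.range (-(tracePairing m₁ m₂).toLinearMap) = ⊤ := by
    rw [LinearMap.range_neg]
    exact LinearEquiv.range _
  rw [← LinearMap.finrank_range_dualMap_eq_finrank_range (commMap A B),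
    ← LinearMap.range_comp_of_range_eq_top _ hr, ← h, LinearMap.range_comp,
    LinearEquiv.finrank_map_eq]

theorem sumMap_apply {q : ℕ} {M : Type*} [AddCommGroup M] [Module ℂ M] (x : Fin q → M) :
    sumMap q M x = ∑ j, x j := by
  simp [sumMap]

theorem psiMap_apply {q m₁ m₂ : ℕ} (A1 : Fin q → Matrix (Fin m₁) (Fin m₁) ℂ)
    (A2 : Fin q → Matrix (Fin m₂) (Fin m₂) ℂ) (Y : Fin q → Matrix (Fin m₁) (Fin m₂) ℂ) (j : Fin q) :
    psiMap A1 A2 Y j = commMap (A1 j) (A2 j) (Y j) := rfl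

theorem finrank_Rsub_add {q m₁ m₂ : ℕ} (A1 : Fin q → Matrix (Fin m₁) (Fin m₁) ℂ)
    (A2 : Fin q → Matrix (Fin m₂) (Fin m₂) ℂ)
    (hs : Function.Surjective (sumMap q (Matrix (Fin m₁) (Fin m₂) ℂ) ∘ₗ psiMap A1 A2)) :
    Module.finrank ℂ (Rsub A1 A2) + m₁ * m₂ =
      ∑ j, Module.finrank ℂ (LinearMap.range (commMap (A1 j) (A2 j))) := by
  set V := fun j => LinearMap.range (commMap (A1 j) (A2 j)) with hV
  let ι : (∀ j, V j) →ₗ[ℂ] (Fin q → Matrix (Fin m₁) (Fin m₂) ℂ) :=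
    LinearMap.pi fun j => (V j).subtype ∘ₗ LinearMap.proj j
  have hι : Function.Injective ι := fun x y h => by
    funext j
    exact Subtype.ext (congrFun h j)
  have hr : ∀ Y, ∃ x, ι x = psiMap A1 A2 Y := fun Y =>
    ⟨fun j => ⟨commMap (A1 j) (A2 j) (Y j), LinearMap.mem_range_self _ _⟩, rfl⟩
  let s := sumMap q (Matrix (Fin m₁) (Fin m₂) ℂ) ∘ₗ ι
  have hR : Rsub A1 A2 = (LinearMap.ker s).map ι := by
    ext b
    constructor
    · rintro ⟨Y, hY, rfl⟩
      obtain ⟨x, hx⟩ := hr Y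
      refine ⟨x, ?_, hx⟩
      change sumMap q _ (ι x) = 0
      rw [hx]
      exact hY
    · rintro ⟨x, hx, rfl⟩
      choose Y hY using fun j => (x j).2
      have hψ : psiMap A1 A2 Y = ι x := funext hY
      refine ⟨Y, ?_, hψ⟩
      change sumMap q _ (psiMap A1 A2 Y) = 0
      rw [hψ]
      exact hx
  have hsurj : LinearMap.range s = ⊤ := by
    rw [LinearMap.range_eq_top]
    intro M
    obtain ⟨Y, hY⟩ := hs M
    obtain ⟨x, hx⟩ := hr Y
    refine ⟨x, ?_⟩
    change sumMap q _ (ι x) = M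
    rw [hx]
    exact hY
  have h := LinearMap.finrank_range_add_finrank_ker s
  rw [hsurj, finrank_top, Module.finrank_matrix, Module.finrank_pi_fintype] at h
  rw [hR, (Submodule.equivMapOfInjective ι hι _).symm.finrank_eq]
  simp at h
  linarith

/-- The image of `(Y_j) ↦ ∑ [Y_j, E_j]` consists of all trace zero matrices as soon as the
tuple `E` has trivial centralizer. -/
theorem exists_sum_commutator_eq {n : Type*} [Fintype n] [DecidableEq n] {q : ℕ}
    {E : Fin q → Matrix n n ℂ} (hE : TrivCent E) {M : Matrix n n ℂ} (hM : M.trace = 0) :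
    ∃ Y : Fin q → Matrix n n ℂ, ∑ j, (Y j * E j - E j * Y j) = M := by
  let T : (Fin q → Matrix n n ℂ) →ₗ[ℂ] Matrix n n ℂ :=
    { toFun := fun Y => ∑ j, (Y j * E j - E j * Y j)
      map_add' := fun Y Y' => by
        rw [← Finset.sum_add_distrib]
        refine Finset.sum_congr rfl fun j _ => ?_
        simp only [Pi.add_apply]
        noncomm_ring
      map_smul' := fun c Y => by simp [Finset.smul_sum, smul_sub] }
  by_contra hne
  have hmem : M ∉ LinearMap.range T := fun ⟨Y, hY⟩ => hne ⟨Y, hY⟩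
  obtain ⟨φ, hφM, hφ⟩ := Submodule.exists_le_ker_of_notMem hmem
  obtain ⟨Z, hZ⟩ := Matrix.exists_trace_mul_eq_dual φ
  have hcomm : ∀ j, Z * E j = E j * Z := by
    intro j
    rw [eq_comm, ← sub_eq_zero]
    refine Matrix.eq_zero_of_forall_trace_mul_eq_zero fun Y => ?_
    have h1 : φ (T (Pi.single j Y)) = 0 := hφ (LinearMap.mem_range_self _ _)
    have h2 : T (Pi.single j Y) = Y * E j - E j * Y := by
      change ∑ i, ((Pi.single j Y : Fin q → Matrix n n ℂ) i * E i -
        E i * (Pi.single j Y : Fin q → Matrix n n ℂ) i) = _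
      rw [Finset.sum_eq_single j]
      · simp
      · intro i _ hi
        simp [Pi.single_eq_of_ne hi]
      · simp
    rw [h2, hZ, Matrix.sub_mul, Matrix.trace_sub, Matrix.mul_assoc (E j), Matrix.trace_mul_comm (E j)]
      at h1
    rw [Matrix.mul_sub, Matrix.trace_sub, ← h1, Matrix.mul_assoc, Matrix.mul_assoc]
  obtain ⟨κ, rfl⟩ := hE Z hcomm
  apply hφM
  simp [hZ, hM]

open Filter Topology in
theorem Submodule.mem_of_frequently_of_hasDerivAt {V : Type*} [NormedAddCommGroup V]
    [NormedSpace ℂ V] [FiniteDimensional ℂ V] (P : Submodule ℂ V) {B : ℂ → V} {B' : V}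
    (hB : HasDerivAt B B' 0) (h : ∃ᶠ t in 𝓝[≠] (0 : ℂ), B t ∈ P) : B 0 ∈ P ∧ B' ∈ P := by
  have hP : IsClosed (P : Set V) := P.closed_of_finiteDimensional
  have h0 : B 0 ∈ P := hP.mem_of_frequently_of_tendsto h
    (hB.continuousAt.tendsto.mono_left nhdsWithin_le_nhds)
  refine ⟨h0, hP.mem_of_frequently_of_tendsto (h.mono fun t ht => ?_) hB.tendsto_slope⟩
  rw [SetLike.mem_coe, slope_def_module]
  exact P.smul_mem _ (P.sub_mem ht h0)

open Filter Topology in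
/-- A solution of the linearised equation `∑ [Y_j, E_j] = 0` integrates to a curve of tuples
`G t E G t⁻¹` with constant sum, provided `(Y_j) ↦ ∑ [Y_j, E_j]` maps onto a subspace `W`
which contains all the differences `∑ g_j E_j g_j⁻¹ - ∑ E_j`. -/
theorem exists_conj_curve {R : Type*} [NormedRing R] [NormedAlgebra ℂ R] [FiniteDimensional ℂ R]
    {q : ℕ} (E : Fin q → R) (W : Submodule ℂ R)
    (hW : ∀ w ∈ W, ∃ Y : Fin q → R, ∑ j, (Y j * E j - E j * Y j) = w)
    (hconj : ∀ g : Fin q → Rˣ, ∑ j, (g j * E j * ↑(g j)⁻¹ - E j) ∈ W)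
    (Y : Fin q → R) (hY : ∑ j, (Y j * E j - E j * Y j) = 0) :
    ∃ B : ℂ → Fin q → R, B 0 = E ∧ HasDerivAt B (fun j => Y j * E j - E j * Y j) 0 ∧
      ∀ᶠ t in 𝓝 (0 : ℂ), (∑ j, B t j = ∑ j, E j) ∧
        ∃ g : Fin q → Rˣ, ∀ j, B t j = g j * E j * ↑(g j)⁻¹ := by
  have : CompleteSpace R := FiniteDimensional.complete ℂ R
  obtain ⟨π, hπ⟩ := W.subtype.exists_leftInverse_of_injective (LinearMap.ker_eq_bot.2 W.injective_subtype)
  let π' : R →L[ℂ] W := LinearMap.toContinuousLinearMap π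
  have hπ' : ∀ w ∈ W, (π' w : R) = w := fun w hw =>
    congrArg Subtype.val (LinearMap.congr_fun hπ ⟨w, hw⟩)
  let C : (Fin q → R) → Fin q → R := fun G j => G j * E j * Ring.inverse (G j)
  let C' : (Fin q → R) →L[ℂ] (Fin q → R) := ContinuousLinearMap.pi fun j =>
    ((ContinuousLinearMap.mul ℂ R).flip (E j) - ContinuousLinearMap.mul ℂ R (E j)) ∘L
      ContinuousLinearMap.proj j
  have hC' : ∀ Z j, C' Z j = Z j * E j - E j * Z j := fun Z j => rfl
  have hC1 : C 1 = E := by ext j; simp [C]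
  have hC : HasStrictFDerivAt C C' 1 := by
    rw [hasStrictFDerivAt_pi']
    intro j
    have hp : HasStrictFDerivAt (fun G : Fin q → R => G j)
      (ContinuousLinearMap.proj (R := ℂ) (φ := fun _ : Fin q => R) j) 1 :=
      (ContinuousLinearMap.proj (R := ℂ) (φ := fun _ : Fin q => R) j).hasStrictFDerivAt
    have hi : HasStrictFDerivAt (fun G : Fin q → R => Ring.inverse (G j)) _ 1 :=
      HasStrictFDerivAt.comp (g := Ring.inverse) (f := fun G : Fin q → R => G j) 1
        (hasStrictFDerivAt_ringInverse (𝕜 := ℂ) (1 : Rˣ)) hp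
    refine ((hp.mul_const' (E j)).mul' hi).congr_fderiv ?_
    ext Z
    simp [hC']
    abel
  let S : (Fin q → R) →L[ℂ] R := ∑ j, ContinuousLinearMap.proj j
  have hS : ∀ Z, S Z = ∑ j, Z j := fun Z => by simp [S]
  have hf : HasStrictFDerivAt (fun G => π' (S (C G))) (π' ∘L S ∘L C') 1 :=
    (π' ∘L S).hasStrictFDerivAt.comp 1 hC
  have hf' : (π' ∘L S ∘L C').range = ⊤ := by
    rw [LinearMap.range_eq_top]
    intro w
    obtain ⟨Z, hZ⟩ := hW w w.2
    refine ⟨Z, Subtype.ext ?_⟩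
    change ((π' (S (C' Z)) : W) : R) = w
    rw [hS]
    simp only [hC', hZ]
    exact hπ' w w.2
  have hYk : Y ∈ (π' ∘L S ∘L C').ker := by
    change π' (S (C' Y)) = 0
    rw [hS]
    simp only [hC', hY, map_zero]
  let G : ℂ → Fin q → R := fun t => hf.implicitFunction _ _ hf' (π' (S (C 1))) (t • ⟨Y, hYk⟩)
  have hG0 : G 0 = 1 := by
    simp only [G, zero_smul]
    exact hf.implicitFunction_apply_image hf'
  have hlin : HasDerivAt (fun t : ℂ => t • (⟨Y, hYk⟩ : (π' ∘L S ∘L C').ker)) ⟨Y, hYk⟩ 0 := by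
    have h := (hasDerivAt_id (0 : ℂ)).smul_const (⟨Y, hYk⟩ : (π' ∘L S ∘L C').ker)
    rwa [one_smul] at h
  have hGd : HasDerivAt G Y 0 := by
    have h1 := (hf.to_implicitFunction hf').hasFDerivAt
    rw [← zero_smul ℂ (⟨Y, hYk⟩ : (π' ∘L S ∘L C').ker)] at h1
    exact h1.comp_hasDerivAt (0 : ℂ) hlin
  refine ⟨fun t => C (G t), by simp only [hG0, hC1], ?_, ?_⟩
  · have h1 := hC.hasFDerivAt
    rw [← hG0] at h1
    exact h1.comp_hasDerivAt (0 : ℂ) hGd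
  · have hev1 : ∀ᶠ t in 𝓝 (0 : ℂ), π' (S (C (G t))) = π' (S (C 1)) := by
      have ht : Tendsto (fun t : ℂ => (π' (S (C 1)), t • (⟨Y, hYk⟩ : (π' ∘L S ∘L C').ker)))
          (𝓝 0) (𝓝 (π' (S (C 1)), 0)) := by
        refine Tendsto.prodMk_nhds tendsto_const_nhds ?_
        have h := hlin.continuousAt.tendsto
        rwa [zero_smul] at h
      exact ht.eventually (hf.map_implicitFunction_eq hf')
    have hev2 : ∀ᶠ t in 𝓝 (0 : ℂ), ∀ j, IsUnit (G t j) := by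
      rw [eventually_all]
      intro j
      have hc : ContinuousAt (fun t => G t j) 0 :=
        (continuous_apply j).continuousAt.comp hGd.continuousAt
      refine hc.eventually (Units.isOpen.mem_nhds ?_)
      simp [hG0]
    filter_upwards [hev1, hev2] with t h1 h2
    choose g hg using h2
    have hCg : ∀ j, C (G t) j = g j * E j * ↑(g j)⁻¹ := fun j => by
      simp [C, ← hg]
    refine ⟨?_, g, hCg⟩
    have hw := hconj g
    simp only [← hCg] at hw
    rw [Finset.sum_sub_distrib] at hw
    have h3 := hπ' _ hw
    rw [hS, hS, hC1, ← sub_eq_zero, ← map_sub] at h1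
    rw [h1] at h3
    exact sub_eq_zero.1 h3.symm

theorem Module.End.finite_setOf_invariant {V ι : Type*} [AddCommGroup V] [Module ℂ V]
    [FiniteDimensional ℂ V] [Fintype ι] [DecidableEq ι] (f : Module.End ℂ V) {μ : ι → ℂ}
    (hμ : Function.Injective μ) (h : ∀ i, f.HasEigenvalue (μ i))
    (hcard : Fintype.card ι = Module.finrank ℂ V) :
    {U : Submodule ℂ V | ∀ x ∈ U, f x ∈ U}.Finite := by
  choose v hv using fun i => (h i).exists_hasEigenvector
  have hli := f.eigenvectors_linearIndependent' μ hμ v hv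
  let b := basisOfLinearIndependentOfCardEqFinrank' v hli hcard
  have hb : ∀ i, b i = v i := fun i => by simp [b]
  have hspan : ∀ U : Submodule ℂ V, (∀ x ∈ U, f x ∈ U) →
      U = Submodule.span ℂ (v '' {i | v i ∈ U}) := by
    intro U hU
    apply le_antisymm
    · intro x hx
      have haeval : ∀ g : ℂ[X], aeval f g x ∈ U := by
        intro g
        induction g using Polynomial.induction_on' with
        | add g g' hg hg' =>
          rw [map_add]
          exact U.add_mem hg hg'
        | monomial k c =>
          have hk : (f ^ k) x ∈ U := by
            induction k with
            | zero => exact hx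
            | succ k ih =>
              rw [pow_succ']
              exact hU _ ih
          rw [aeval_monomial, Module.End.mul_apply, Module.algebraMap_end_apply]
          exact U.smul_mem _ hk
      have hproj : ∀ i, aeval f (Lagrange.basis Finset.univ μ i) x = b.repr x i • v i := by
        intro i
        conv_lhs => rw [← b.sum_repr x]
        rw [map_sum, Finset.sum_eq_single i]
        · rw [map_smul, hb, Module.End.aeval_apply_of_hasEigenvector (hv i),
            Lagrange.eval_basis_self hμ.injOn (Finset.mem_univ i), one_smul]
        · intro k _ hk
          rw [map_smul, hb, Module.End.aeval_apply_of_hasEigenvector (hv k),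
            Lagrange.eval_basis_of_ne (Ne.symm hk) (Finset.mem_univ k), zero_smul, smul_zero]
        · simp
      rw [← b.sum_repr x]
      refine Submodule.sum_mem _ fun i _ => ?_
      rw [hb]
      by_cases hi : b.repr x i = 0
      · simp [hi]
      · refine Submodule.smul_mem _ _ (Submodule.subset_span ⟨i, ?_, rfl⟩)
        have := haeval (Lagrange.basis Finset.univ μ i)
        rw [hproj] at this
        exact (U.smul_mem_iff hi).1 this
    · rw [Submodule.span_le]
      rintro _ ⟨i, hi, rfl⟩
      exact hi
  refine Set.Finite.of_injOn (f := fun U => {i | v i ∈ U}) (t := Set.univ)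
    (fun _ _ => Set.mem_univ _) ?_ Set.finite_univ
  intro U hU U' hU' hUU'
  rw [hspan U hU, hspan U' hU']
  exact congrArg (fun s => Submodule.span ℂ (v '' s)) hUU'

theorem Matrix.finite_setOf_invariant {n : Type*} [Fintype n] [DecidableEq n] (M : Matrix n n ℂ)
    {μ : n → ℂ} (hμ : Function.Injective μ) (hM : M.charpoly = ∏ i, (Polynomial.X - C (μ i))) :
    {U : Submodule ℂ (n → ℂ) | ∀ x ∈ U, M *ᵥ x ∈ U}.Finite := by
  refine Module.End.finite_setOf_invariant (Matrix.toLin' M) hμ (fun i => ?_) (by simp)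
  rw [Module.End.hasEigenvalue_iff_mem_spectrum, Matrix.spectrum_toLin',
    Matrix.mem_spectrum_iff_isRoot_charpoly, hM, Polynomial.IsRoot, Polynomial.eval_prod]
  exact Finset.prod_eq_zero (Finset.mem_univ i) (by simp)

theorem eq_bot_or_top_or_of_invariant_fromBlocks {q m₁ m₂ : ℕ}
    {a : Fin q → Matrix (Fin m₁) (Fin m₁) ℂ} {d : Fin q → Matrix (Fin m₂) (Fin m₂) ℂ}
    {b : Fin q → Matrix (Fin m₁) (Fin m₂) ℂ} (ha : IrredTuple a) (hd : IrredTuple d) {l : Fin q}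
    (hl : IsCoprime (a l).charpoly (d l).charpoly) (hbl : b l = 0) (hb : b ≠ 0)
    {U : Submodule ℂ (Fin m₁ ⊕ Fin m₂ → ℂ)}
    (hU : ∀ j, ∀ v ∈ U, Matrix.fromBlocks (a j) (b j) 0 (d j) *ᵥ v ∈ U) :
    U = ⊥ ∨ U = ⊤ ∨ ∀ v, v ∈ U ↔ v ∘ Sum.inr = 0 := by
  have hinv : ∀ j x y, Sum.elim x y ∈ U →
      Sum.elim (a j *ᵥ x + b j *ᵥ y) (d j *ᵥ y) ∈ U := by
    intro j x y h
    have := hU j _ h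
    rw [Matrix.fromBlocks_mulVec] at this
    simpa using this
  let i₁ : (Fin m₁ → ℂ) →ₗ[ℂ] (Fin m₁ ⊕ Fin m₂ → ℂ) :=
    { toFun := fun x => Sum.elim x 0
      map_add' := fun x y => by ext (i | i) <;> simp
      map_smul' := fun c x => by ext (i | i) <;> simp }
  have hi₁ : ∀ x, i₁ x = Sum.elim x 0 := fun _ => rfl
  let p₂ : (Fin m₁ ⊕ Fin m₂ → ℂ) →ₗ[ℂ] (Fin m₂ → ℂ) := LinearMap.funLeft ℂ ℂ Sum.inr
  have hp₂ : ∀ v, p₂ v = v ∘ Sum.inr := fun _ => rfl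
  have h1 := ha (U.comap i₁) fun j x hx => by
    have := hinv j x 0 hx
    simp only [Matrix.mulVec_zero, add_zero] at this
    exact this
  have h2 := hd (U.map p₂) fun j y hy => by
    obtain ⟨v, hv, rfl⟩ := hy
    refine ⟨_, hU j v hv, ?_⟩
    rw [Matrix.fromBlocks_mulVec, hp₂, hp₂]
    simp
  have hdec : ∀ v : Fin m₁ ⊕ Fin m₂ → ℂ, v ∘ Sum.inr = 0 → v = i₁ (v ∘ Sum.inl) := by
    intro v hv
    rw [hi₁, ← hv, Sum.elim_comp_inl_inr]
  rcases h1 with h1 | h1 <;> rcases h2 with h2 | h2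
  · left
    rw [eq_bot_iff]
    intro v hv
    have hv2 : v ∘ Sum.inr = 0 := by
      have : p₂ v ∈ U.map p₂ := Submodule.mem_map_of_mem hv
      rwa [h2] at this
    have hv1 : v ∘ Sum.inl ∈ U.comap i₁ := by
      rw [Submodule.mem_comap, ← hdec v hv2]
      exact hv
    rw [h1, Submodule.mem_bot] at hv1
    rw [Submodule.mem_bot, hdec v hv2, hv1, map_zero]
  · exfalso
    have huniq : ∀ x x' y, Sum.elim x y ∈ U → Sum.elim x' y ∈ U → x = x' := by
      intro x x' y h h'
      have hx : x - x' ∈ U.comap i₁ := by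
        have hs := U.sub_mem h h'
        rw [Submodule.mem_comap, hi₁]
        convert hs using 1
        ext (i | i) <;> simp
      rw [h1, Submodule.mem_bot] at hx
      exact sub_eq_zero.1 hx
    have hex : ∀ y, ∃ x, Sum.elim x y ∈ U := by
      intro y
      have hy : y ∈ U.map p₂ := h2 ▸ Submodule.mem_top
      obtain ⟨v, hv, rfl⟩ := hy
      refine ⟨v ∘ Sum.inl, ?_⟩
      rw [hp₂, Sum.elim_comp_inl_inr]
      exact hv
    choose s hs using hex
    let S' : (Fin m₂ → ℂ) →ₗ[ℂ] (Fin m₁ → ℂ) :=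
      { toFun := s
        map_add' := fun y y' => huniq _ _ _ (hs _) (by
          convert U.add_mem (hs y) (hs y') using 1
          ext (i | i) <;> simp)
        map_smul' := fun c y => huniq _ _ _ (hs _) (by
          convert U.smul_mem c (hs y) using 1
          ext (i | i) <;> simp) }
    let S := LinearMap.toMatrix' S'
    have hS : ∀ y, s y = S *ᵥ y := fun y => (LinearMap.toMatrix'_mulVec S' y).symm
    have hS0 : S = 0 := by
      refine Matrix.eq_zero_of_mul_eq_mul_of_isCoprime_charpoly hl (Matrix.ext_of_mulVec_single ?_)
      intro k
      have h := hinv l _ _ (hs (Pi.single k 1))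
      rw [hbl, Matrix.zero_mulVec, add_zero] at h
      have := huniq _ _ _ h (hs _)
      rwa [hS, hS, Matrix.mulVec_mulVec, Matrix.mulVec_mulVec] at this
    apply hb
    funext j
    refine Matrix.ext_of_mulVec_single fun k => ?_
    have h := hinv j _ _ (hs (Pi.single k 1))
    have h := huniq _ _ _ h (hs _)
    rw [hS, hS, hS0, Matrix.zero_mulVec, Matrix.zero_mulVec, Matrix.mulVec_zero, zero_add] at h
    rw [h, Pi.zero_apply, Matrix.zero_mulVec]
  · right; right
    intro v
    constructor
    · intro hv
      have : p₂ v ∈ U.map p₂ := Submodule.mem_map_of_mem hv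
      rwa [h2] at this
    · intro hv
      have : v ∘ Sum.inl ∈ U.comap i₁ := h1 ▸ Submodule.mem_top
      rw [hdec v hv]
      exact this
  · right; left
    rw [eq_top_iff]
    intro v _
    have hy : p₂ v ∈ U.map p₂ := h2 ▸ Submodule.mem_top
    obtain ⟨u, hu, huv⟩ := hy
    have hvu : v - u = i₁ ((v - u) ∘ Sum.inl) := hdec _ (by
      rw [← hp₂, map_sub, huv, sub_self])
    have : (v - u) ∘ Sum.inl ∈ U.comap i₁ := h1 ▸ Submodule.mem_top
    rw [Submodule.mem_comap, ← hvu] at this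
    simpa using U.add_mem this hu

theorem trivCent_fromBlocks {q m₁ m₂ : ℕ}
    {a : Fin q → Matrix (Fin m₁) (Fin m₁) ℂ} {d : Fin q → Matrix (Fin m₂) (Fin m₂) ℂ}
    {b : Fin q → Matrix (Fin m₁) (Fin m₂) ℂ} (ha : TrivCent a) (hd : TrivCent d) {l : Fin q}
    (hl : IsCoprime (a l).charpoly (d l).charpoly) (hbl : b l = 0) (hb : b ≠ 0) :
    TrivCent fun j => Matrix.fromBlocks (a j) (b j) 0 (d j) := by
  intro Z hZ
  obtain ⟨u, y, z, v, rfl⟩ : ∃ u y z v, Z = Matrix.fromBlocks u y z v :=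
    ⟨_, _, _, _, (Matrix.fromBlocks_toBlocks Z).symm⟩
  simp only [Matrix.fromBlocks_multiply, Matrix.fromBlocks_inj, Matrix.mul_zero, add_zero,
    Matrix.zero_mul, zero_add] at hZ
  have hy : y = 0 := by
    have := (hZ l).2.1
    rw [hbl, Matrix.mul_zero, Matrix.zero_mul, zero_add, add_zero] at this
    exact Matrix.eq_zero_of_mul_eq_mul_of_isCoprime_charpoly hl this.symm
  have hz : z = 0 :=
    Matrix.eq_zero_of_mul_eq_mul_of_isCoprime_charpoly hl.symm (hZ l).2.2.1.symm
  subst hy hz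
  obtain ⟨κ, rfl⟩ := ha u fun j => by simpa using (hZ j).1
  obtain ⟨κ', rfl⟩ := hd v fun j => by simpa using (hZ j).2.2.2
  obtain ⟨j, hj⟩ := Function.ne_iff.1 hb
  have hκ : κ = κ' := by
    have := (hZ j).2.1
    simp only [Matrix.smul_mul, Matrix.mul_smul, Matrix.one_mul, Matrix.mul_one, Matrix.zero_mul,
      Matrix.mul_zero, add_zero, zero_add] at this
    exact smul_left_injective ℂ hj this
  refine ⟨κ, ?_⟩
  rw [← hκ, ← Matrix.fromBlocks_one, Matrix.fromBlocks_smul, smul_zero, smul_zero]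

theorem TrivCent.comp_castSucc {n : Type*} [Fintype n] [DecidableEq n] {p : ℕ}
    {E : Fin (p + 1) → Matrix n n ℂ} (hE : TrivCent E) (hsum : ∑ j, E j = 0) :
    TrivCent fun j : Fin p => E j.castSucc := by
  intro Z hZ
  refine hE Z fun j => ?_
  induction j using Fin.lastCases with
  | cast j => exact hZ j
  | last =>
    rw [Fin.sum_univ_castSucc, add_comm] at hsum
    rw [eq_neg_of_add_eq_zero_left hsum, Matrix.mul_neg, Matrix.neg_mul, Matrix.mul_sum,
      Matrix.sum_mul]
    simp only [hZ]

theorem two_le_finrank_Rsub_castSucc {p m₁ m₂ : ℕ}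
    {A1 : Fin (p + 1) → Matrix (Fin m₁) (Fin m₁) ℂ}
    {A2 : Fin (p + 1) → Matrix (Fin m₂) (Fin m₂) ℂ}
    (hsum1 : ∑ j, A1 j = 0) (hsum2 : ∑ j, A2 j = 0)
    (hcop : IsCoprime (A1 (Fin.last p)).charpoly (A2 (Fin.last p)).charpoly)
    (hxi : Module.finrank ℂ (Qsub A1 A2) + 2 ≤ Module.finrank ℂ (Rsub A1 A2)) :
    2 ≤ Module.finrank ℂ (Rsub (fun j : Fin p => A1 j.castSucc) fun j => A2 j.castSucc) ∧
    2 ≤ Module.finrank ℂ (Rsub (fun j : Fin p => A2 j.castSucc) fun j => A1 j.castSucc) := by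
  have hinj : ∀ {m₁ m₂ : ℕ} {A : Matrix (Fin m₁) (Fin m₁) ℂ} {D : Matrix (Fin m₂) (Fin m₂) ℂ},
      IsCoprime A.charpoly D.charpoly → Function.Injective (commMap A D) := by
    intro m₁ m₂ A D h
    rw [← LinearMap.ker_eq_bot, LinearMap.ker_eq_bot']
    intro Y hY
    exact Matrix.eq_zero_of_mul_eq_mul_of_isCoprime_charpoly h (sub_eq_zero.1 hY)
  have hsurj : ∀ {m₁ m₂ : ℕ} {A1 : Fin (p + 1) → Matrix (Fin m₁) (Fin m₁) ℂ}
      {A2 : Fin (p + 1) → Matrix (Fin m₂) (Fin m₂) ℂ}, ∑ j, A1 j = 0 → ∑ j, A2 j = 0 →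
      IsCoprime (A1 (Fin.last p)).charpoly (A2 (Fin.last p)).charpoly →
      Function.Surjective (sumMap p (Matrix (Fin m₁) (Fin m₂) ℂ) ∘ₗ
        psiMap (fun j : Fin p => A1 j.castSucc) fun j => A2 j.castSucc) := by
    intro m₁ m₂ A1 A2 hsum1 hsum2 hcop M
    obtain ⟨Y, hY⟩ := (LinearMap.injective_iff_surjective.1 (hinj hcop)) (-M)
    refine ⟨fun _ => Y, ?_⟩
    rw [Fin.sum_univ_castSucc] at hsum1 hsum2
    rw [LinearMap.comp_apply, sumMap_apply]
    simp only [psiMap_apply, commMap_apply]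
    rw [Finset.sum_sub_distrib, ← Matrix.sum_mul, ← Matrix.mul_sum,
      eq_neg_of_add_eq_zero_left hsum1, eq_neg_of_add_eq_zero_left hsum2, ← neg_eq_iff_eq_neg.2 hY,
      commMap_apply, Matrix.neg_mul, Matrix.mul_neg]
    abel
  have hlast : Function.Surjective
      (sumMap (p + 1) (Matrix (Fin m₁) (Fin m₂) ℂ) ∘ₗ psiMap A1 A2) := by
    intro M
    obtain ⟨Y, hY⟩ := (LinearMap.injective_iff_surjective.1 (hinj hcop)) M
    refine ⟨Pi.single (Fin.last p) Y, ?_⟩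
    rw [LinearMap.comp_apply, sumMap_apply, Finset.sum_eq_single (Fin.last p)]
    · simpa [psiMap_apply] using hY
    · intro j _ hj
      simp [psiMap_apply, Pi.single_eq_of_ne hj]
    · simp
  have hQ : Module.finrank ℂ (Qsub A1 A2) = m₁ * m₂ := by
    rw [Qsub, LinearMap.finrank_range_of_inj]
    · simp [Module.finrank_matrix]
    · intro Y Y' h
      exact hinj hcop (congrFun h (Fin.last p))
  have hL : Module.finrank ℂ (LinearMap.range (commMap (A1 (Fin.last p)) (A2 (Fin.last p)))) =
      m₁ * m₂ := by
    rw [LinearMap.finrank_range_of_inj (hinj hcop)]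
    simp [Module.finrank_matrix]
  have e1 := finrank_Rsub_add A1 A2 hlast
  have e2 := finrank_Rsub_add _ _ (hsurj hsum1 hsum2 hcop)
  have e3 := finrank_Rsub_add _ _ (hsurj hsum2 hsum1 hcop.symm)
  simp only [finrank_range_commMap_comm] at e3
  rw [Fin.sum_univ_castSucc, hL] at e1
  rw [mul_comm m₂ m₁] at e3
  constructor <;> linarith

theorem exists_ne_zero_of_mem_Rsub {q m₁ m₂ : ℕ} {A1 : Fin q → Matrix (Fin m₁) (Fin m₁) ℂ}
    {A2 : Fin q → Matrix (Fin m₂) (Fin m₂) ℂ} (h : 2 ≤ Module.finrank ℂ (Rsub A1 A2))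
    (φ : Module.Dual ℂ (Fin q → Matrix (Fin m₁) (Fin m₂) ℂ)) :
    ∃ Y, psiMap A1 A2 Y ≠ 0 ∧ ∑ j, psiMap A1 A2 Y j = 0 ∧ φ (psiMap A1 A2 Y) = 0 := by
  have hk := LinearMap.finrank_range_add_finrank_ker (φ ∘ₗ (Rsub A1 A2).subtype)
  have hr := Submodule.finrank_le (LinearMap.range (φ ∘ₗ (Rsub A1 A2).subtype))
  rw [Module.finrank_self] at hr
  have hpos : 0 < Module.finrank ℂ (LinearMap.ker (φ ∘ₗ (Rsub A1 A2).subtype)) := by omega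
  obtain ⟨⟨b, Y, hY, rfl⟩, hb, hne⟩ := Submodule.exists_mem_ne_zero_of_ne_bot
    (p := LinearMap.ker (φ ∘ₗ (Rsub A1 A2).subtype)) fun h0 => by
      rw [h0, finrank_bot] at hpos
      exact hpos.false
  refine ⟨Y, fun h0 => hne (Subtype.ext h0), ?_, hb⟩
  rw [← sumMap_apply]
  exact hY

/-- Existence of a first order deformation of an extension which keeps the conjugacy classes and
the sum, but does not preserve the subrepresentation. -/
theorem exists_tangent {p m₁ m₂ : ℕ}
    {a : Fin p → Matrix (Fin m₁) (Fin m₁) ℂ} {d : Fin p → Matrix (Fin m₂) (Fin m₂) ℂ}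
    (ha : TrivCent a) (hd : TrivCent d) {α : Matrix (Fin m₁) (Fin m₁) ℂ}
    {δ : Matrix (Fin m₂) (Fin m₂) ℂ} (haα : ∑ j, a j = -α) (hdδ : ∑ j, d j = -δ)
    (hcop : IsCoprime α.charpoly δ.charpoly)
    (Y : Fin p → Matrix (Fin m₁) (Fin m₂) ℂ) (hR : 2 ≤ Module.finrank ℂ (Rsub d a)) :
    ∃ T : Fin p → Matrix (Fin m₁ ⊕ Fin m₂) (Fin m₁ ⊕ Fin m₂) ℂ,
      ∑ j, (T j * Matrix.fromBlocks (a j) (psiMap a d Y j) 0 (d j) -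
        Matrix.fromBlocks (a j) (psiMap a d Y j) 0 (d j) * T j) = 0 ∧
      ∃ j, (T j * Matrix.fromBlocks (a j) (psiMap a d Y j) 0 (d j) -
        Matrix.fromBlocks (a j) (psiMap a d Y j) 0 (d j) * T j).toBlocks₂₁ ≠ 0 := by
  set b := psiMap a d Y with hb
  let φ : Module.Dual ℂ (Fin p → Matrix (Fin m₂) (Fin m₁) ℂ) :=
    ∑ j, (tracePairing m₂ m₁ (Y j)) ∘ₗ LinearMap.proj j
  have hφ : ∀ c, φ c = ∑ j, (c j * Y j).trace := fun c => by
    simp [φ, tracePairing_apply]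
  obtain ⟨z, hz0, hzs, hzφ⟩ := exists_ne_zero_of_mem_Rsub hR φ
  have htr : ∑ j, (b j * z j).trace = 0 := by
    simp only [hb, psiMap_apply, trace_commMap_mul]
    rw [Finset.sum_neg_distrib, neg_eq_zero, ← hzφ, hφ]
    exact Finset.sum_congr rfl fun j _ => Matrix.trace_mul_comm _ _
  obtain ⟨x, hx⟩ := exists_sum_commutator_eq ha (M := ∑ j, b j * z j) (by
    rw [Matrix.trace_sum, htr])
  obtain ⟨w, hw⟩ := exists_sum_commutator_eq hd (M := -∑ j, z j * b j) (by
    rw [Matrix.trace_neg, Matrix.trace_sum, neg_eq_zero, ← htr]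
    exact Finset.sum_congr rfl fun j _ => Matrix.trace_mul_comm _ _)
  have hinj : Function.Injective (commMap α δ) := by
    rw [← LinearMap.ker_eq_bot, LinearMap.ker_eq_bot']
    intro Y hY
    exact Matrix.eq_zero_of_mul_eq_mul_of_isCoprime_charpoly hcop (sub_eq_zero.1 hY)
  obtain ⟨y, hy⟩ := LinearMap.injective_iff_surjective.1 hinj (-∑ j, (x j * b j - b j * w j))
  have hmul : ∀ j, Matrix.fromBlocks (x j) y (z j) (w j) * Matrix.fromBlocks (a j) (b j) 0 (d j) -
      Matrix.fromBlocks (a j) (b j) 0 (d j) * Matrix.fromBlocks (x j) y (z j) (w j) =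
      Matrix.fromBlocks ((x j * a j - a j * x j) - b j * z j)
        ((x j * b j - b j * w j) - (a j * y - y * d j))
        (-psiMap d a z j) (z j * b j + (w j * d j - d j * w j)) := by
    intro j
    rw [Matrix.fromBlocks_multiply, Matrix.fromBlocks_multiply, sub_eq_add_neg,
      Matrix.fromBlocks_neg, Matrix.fromBlocks_add, psiMap_apply, commMap_apply]
    congr 1 <;> simp <;> abel
  have hsumBlocks : ∀ (e : Fin p → Matrix (Fin m₁) (Fin m₁) ℂ) (f : Fin p → Matrix (Fin m₁) (Fin m₂) ℂ)
      (g : Fin p → Matrix (Fin m₂) (Fin m₁) ℂ) (h : Fin p → Matrix (Fin m₂) (Fin m₂) ℂ),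
      ∑ j, Matrix.fromBlocks (e j) (f j) (g j) (h j) =
        Matrix.fromBlocks (∑ j, e j) (∑ j, f j) (∑ j, g j) (∑ j, h j) := by
    intro e f g h
    ext (i | i) (k | k) <;> simp [Matrix.sum_apply]
  refine ⟨fun j => Matrix.fromBlocks (x j) y (z j) (w j), ?_, ?_⟩
  · simp only [hmul]
    rw [hsumBlocks, ← Matrix.fromBlocks_zero]
    congr 1
    · rw [Finset.sum_sub_distrib, hx, sub_self]
    · rw [Finset.sum_sub_distrib, ← neg_eq_iff_eq_neg.2 hy, commMap_apply, Finset.sum_sub_distrib,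
        ← Matrix.sum_mul, ← Matrix.mul_sum, haα, hdδ, Matrix.neg_mul, Matrix.mul_neg]
      abel
    · rw [Finset.sum_neg_distrib, hzs, neg_zero]
    · rw [Finset.sum_add_distrib, hw, add_neg_cancel]
  · obtain ⟨j, hj⟩ := Function.ne_iff.1 hz0
    refine ⟨j, ?_⟩
    simp only [hmul, Matrix.toBlocks_fromBlocks₂₁]
    exact neg_ne_zero.2 hj

/-- The tuples of matrices leaving a subspace invariant. -/
def tupleStabilizer {n : Type*} [Fintype n] (q : ℕ) (U : Submodule ℂ (n → ℂ)) :
    Submodule ℂ (Fin q → Matrix n n ℂ) where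
  carrier := {B | ∀ j, ∀ v ∈ U, B j *ᵥ v ∈ U}
  add_mem' := fun {B B'} hB hB' j v hv => by
    rw [Pi.add_apply, Matrix.add_mulVec]
    exact U.add_mem (hB j v hv) (hB' j v hv)
  zero_mem' := fun j v _ => by
    rw [Pi.zero_apply, Matrix.zero_mulVec]
    exact U.zero_mem
  smul_mem' := fun c B hB j v hv => by
    rw [Pi.smul_apply, Matrix.smul_mulVec]
    exact U.smul_mem c (hB j v hv)

open Filter Topology in
attribute [local instance] Matrix.linftyOpNormedRing Matrix.linftyOpNormedAlgebra in
/-- If a solution of the linearised problem preserves no common invariant subspace of a tuple `E`,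
and the invariant subspaces of a matrix `L` are finite in number, then `E` can be deformed within
its conjugacy classes, with fixed sum, to a tuple without common invariant subspace for it
and `L`. -/
theorem exists_conj_irreducible {n : Type*} [Fintype n] [DecidableEq n] {q : ℕ}
    {E : Fin q → Matrix n n ℂ} (hE : TrivCent E) {L : Matrix n n ℂ}
    (hL : {U : Submodule ℂ (n → ℂ) | ∀ v ∈ U, L *ᵥ v ∈ U}.Finite)
    {T : Fin q → Matrix n n ℂ} (hT : ∑ j, (T j * E j - E j * T j) = 0)
    (hTU : ∀ U : Submodule ℂ (n → ℂ), (∀ v ∈ U, L *ᵥ v ∈ U) → E ∈ tupleStabilizer q U →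
      (fun j => T j * E j - E j * T j) ∈ tupleStabilizer q U → U = ⊥ ∨ U = ⊤) :
    ∃ g : Fin q → (Matrix n n ℂ)ˣ, ∑ j, (g j : Matrix n n ℂ) * E j * (↑(g j)⁻¹ : Matrix n n ℂ) = ∑ j, E j ∧
      ∀ U : Submodule ℂ (n → ℂ), (∀ v ∈ U, L *ᵥ v ∈ U) →
        (fun j => (g j : Matrix n n ℂ) * E j * (↑(g j)⁻¹ : Matrix n n ℂ)) ∈ tupleStabilizer q U → U = ⊥ ∨ U = ⊤ := by
  obtain ⟨B, hB0, hBd, hBc⟩ := exists_conj_curve E (LinearMap.ker (Matrix.traceLinearMap n ℂ ℂ))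
    (fun w hw => exists_sum_commutator_eq hE hw)
    (fun g => by
      change Matrix.trace _ = 0
      rw [Matrix.trace_sum]
      refine Finset.sum_eq_zero fun j _ => ?_
      rw [Matrix.trace_sub, Matrix.trace_units_conj, sub_self]) T hT
  by_contra! hno
  have hbad : ∀ᶠ t in 𝓝[≠] (0 : ℂ), ∃ U : Submodule ℂ (n → ℂ), (∀ v ∈ U, L *ᵥ v ∈ U) ∧
      B t ∈ tupleStabilizer q U ∧ U ≠ ⊥ ∧ U ≠ ⊤ := by
    refine (hBc.filter_mono nhdsWithin_le_nhds).mono ?_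
    rintro t ⟨hs, g, hg⟩
    have hBt : B t = fun j => (g j : Matrix n n ℂ) * E j * (↑(g j)⁻¹ : Matrix n n ℂ) := funext hg
    obtain ⟨U, hU, hUB, h⟩ := hno g (by simpa only [hBt] using hs)
    exact ⟨U, hU, hBt ▸ hUB, h⟩
  have hgood : ∀ᶠ t in 𝓝[≠] (0 : ℂ), ∀ U ∈ {U : Submodule ℂ (n → ℂ) | ∀ v ∈ U, L *ᵥ v ∈ U},
      ¬ (B t ∈ tupleStabilizer q U ∧ U ≠ ⊥ ∧ U ≠ ⊤) := by
    rw [Filter.eventually_all_finite hL]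
    intro U hU
    by_contra hf
    have hf' : ∃ᶠ t in 𝓝[≠] (0 : ℂ), B t ∈ tupleStabilizer q U ∧ U ≠ ⊥ ∧ U ≠ ⊤ := hf
    obtain ⟨h0, h1⟩ := (tupleStabilizer q U).mem_of_frequently_of_hasDerivAt hBd
      (hf'.mono fun t ht => ht.1)
    obtain ⟨-, -, hb, ht⟩ := hf'.exists
    rw [hB0] at h0
    rcases hTU U hU h0 h1 with h | h
    · exact hb h
    · exact ht h
  obtain ⟨t, ⟨U, hU, h⟩, hn⟩ := (hbad.and hgood).exists
  exact hn U hU h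

theorem fromBlocks_conj_eq {m₁ m₂ : ℕ} (A : Matrix (Fin m₁) (Fin m₁) ℂ)
    (D : Matrix (Fin m₂) (Fin m₂) ℂ) (Y : Matrix (Fin m₁) (Fin m₂) ℂ) :
    ∃ u : (Matrix (Fin m₁ ⊕ Fin m₂) (Fin m₁ ⊕ Fin m₂) ℂ)ˣ,
      Matrix.fromBlocks A (commMap A D Y) 0 D =
        (u : Matrix (Fin m₁ ⊕ Fin m₂) (Fin m₁ ⊕ Fin m₂) ℂ) * Matrix.fromBlocks A 0 0 D *
          (↑u⁻¹ : Matrix (Fin m₁ ⊕ Fin m₂) (Fin m₁ ⊕ Fin m₂) ℂ) := by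
  refine ⟨⟨Matrix.fromBlocks 1 (-Y) 0 1, Matrix.fromBlocks 1 Y 0 1, ?_, ?_⟩, ?_⟩
  · simp [Matrix.fromBlocks_multiply]
  · simp [Matrix.fromBlocks_multiply]
  · rw [Units.inv_mk, commMap_apply]
    simp [Matrix.fromBlocks_multiply, sub_eq_add_neg]

/-- if `P₁`, `P₂` are irreducible and `ξ ≥ 2`, the direct sum can be
deformed into an irreducible tuple with the same conjugacy classes and zero sum. -/
theorem stmt17 (p m₁ m₂ : ℕ) (hp : 2 ≤ p) (h₁ : 1 ≤ m₁) (h₂ : 1 ≤ m₂)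
    (A1 : Fin (p + 1) → Matrix (Fin m₁) (Fin m₁) ℂ)
    (A2 : Fin (p + 1) → Matrix (Fin m₂) (Fin m₂) ℂ)
    (hsum1 : ∑ j, A1 j = 0) (hsum2 : ∑ j, A2 j = 0)
    (htc1 : TrivCent A1) (htc2 : TrivCent A2)
    (ev1 : Fin m₁ → ℂ) (ev2 : Fin m₂ → ℂ)
    (hev1 : Function.Injective ev1 ∧
      (A1 (Fin.last p)).charpoly = ∏ i, (Polynomial.X - Polynomial.C (ev1 i)))
    (hev2 : Function.Injective ev2 ∧
      (A2 (Fin.last p)).charpoly = ∏ i, (Polynomial.X - Polynomial.C (ev2 i)))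
    (hdisj : ∀ i i', ev1 i ≠ ev2 i')
    (hirr1 : IrredTuple A1) (hirr2 : IrredTuple A2)
    (hxi : Module.finrank ℂ (Qsub A1 A2) + 2 ≤ Module.finrank ℂ (Rsub A1 A2)) :
    ∃ B : Fin (p + 1) → Matrix (Fin m₁ ⊕ Fin m₂) (Fin m₁ ⊕ Fin m₂) ℂ,
      (∑ j, B j = 0) ∧
      (∀ j, ∃ g : (Matrix (Fin m₁ ⊕ Fin m₂) (Fin m₁ ⊕ Fin m₂) ℂ)ˣ,
        B j = (g : Matrix (Fin m₁ ⊕ Fin m₂) (Fin m₁ ⊕ Fin m₂) ℂ)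
          * Matrix.fromBlocks (A1 j) 0 0 (A2 j)
          * (↑g⁻¹ : Matrix (Fin m₁ ⊕ Fin m₂) (Fin m₁ ⊕ Fin m₂) ℂ)) ∧
      IrredTuple B := by
  have hcop : IsCoprime (A1 (Fin.last p)).charpoly (A2 (Fin.last p)).charpoly := by
    rw [hev1.2, hev2.2]
    exact IsCoprime.prod_left fun i _ => IsCoprime.prod_right fun i' _ =>
      Polynomial.isCoprime_X_sub_C_of_isUnit_sub (sub_ne_zero.2 (hdisj i i')).isUnit
  obtain ⟨hR, hR'⟩ := two_le_finrank_Rsub_castSucc hsum1 hsum2 hcop hxi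
  obtain ⟨Y, hY0, hYs, -⟩ := exists_ne_zero_of_mem_Rsub hR 0
  have hs1 : ∑ j : Fin p, A1 j.castSucc = -A1 (Fin.last p) := by
    rw [Fin.sum_univ_castSucc] at hsum1
    exact eq_neg_of_add_eq_zero_left hsum1
  have hs2 : ∑ j : Fin p, A2 j.castSucc = -A2 (Fin.last p) := by
    rw [Fin.sum_univ_castSucc] at hsum2
    exact eq_neg_of_add_eq_zero_left hsum2
  obtain ⟨T, hT, k, hk⟩ := exists_tangent (htc1.comp_castSucc hsum1) (htc2.comp_castSucc hsum2)
    hs1 hs2 hcop Y hR'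
  set b := psiMap (fun j : Fin p => A1 j.castSucc) (fun j => A2 j.castSucc) Y with hb
  set E := fun j : Fin p => Matrix.fromBlocks (A1 j.castSucc) (b j) 0 (A2 j.castSucc) with hE
  set L := Matrix.fromBlocks (A1 (Fin.last p)) 0 0 (A2 (Fin.last p)) with hL
  let c : Fin (p + 1) → Matrix (Fin m₁) (Fin m₂) ℂ := Fin.snoc b 0
  have hc0 : c (Fin.last p) = 0 := Fin.snoc_last (α := fun _ => Matrix (Fin m₁) (Fin m₂) ℂ) _ _
  have hcb : ∀ j : Fin p, c j.castSucc = b j := fun j =>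
    Fin.snoc_castSucc (α := fun _ => Matrix (Fin m₁) (Fin m₂) ℂ) _ _ _
  have hc : c ≠ 0 := fun h => hY0 (funext fun j => by rw [← hcb, h]; rfl)
  have hEsum : ∑ j, E j = -L := by
    have : ∑ j, E j = Matrix.fromBlocks (∑ j : Fin p, A1 j.castSucc) (∑ j, b j) 0
        (∑ j : Fin p, A2 j.castSucc) := by
      ext (i | i) (l | l) <;> simp [hE, Matrix.sum_apply]
    rw [this, hs1, hs2, hYs, hL, Matrix.fromBlocks_neg, neg_zero, neg_zero]
  have hEtc : TrivCent E := by
    have h := (trivCent_fromBlocks htc1 htc2 hcop hc0 hc).comp_castSucc (by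
      rw [Fin.sum_univ_castSucc]
      simp only [hcb, hc0]
      rw [hEsum, neg_add_cancel])
    simpa only [hcb] using h
  have hLfin : {U : Submodule ℂ (Fin m₁ ⊕ Fin m₂ → ℂ) | ∀ v ∈ U, L *ᵥ v ∈ U}.Finite := by
    refine Matrix.finite_setOf_invariant L (μ := Sum.elim ev1 ev2)
      (hev1.1.sumElim hev2.1 hdisj) ?_
    rw [hL, Matrix.charpoly_fromBlocks_zero₂₁, hev1.2, hev2.2, Fintype.prod_sum_type]
    simp
  obtain ⟨g, hg, hgU⟩ := exists_conj_irreducible hEtc hLfin hT fun U hUL hUE hUT => by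
    rcases eq_bot_or_top_or_of_invariant_fromBlocks hirr1 hirr2 hcop hc0 hc (U := U) (fun j => by
      induction j using Fin.lastCases with
      | cast j =>
        rw [hcb]
        exact hUE j
      | last =>
        rw [hc0]
        exact hUL) with h | h | h
    · exact Or.inl h
    · exact Or.inr h
    · refine absurd (Matrix.ext_of_mulVec_single fun i => ?_) hk
      have hv : ((T k * E k - E k * T k) *ᵥ Sum.elim (Pi.single i 1) 0) ∘ Sum.inr = 0 :=
        (h _).1 (hUT k (Sum.elim (Pi.single i 1) 0)
          ((h _).2 (Sum.elim_comp_inr _ _)))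
      rw [← Matrix.fromBlocks_toBlocks (T k * E k - E k * T k), Matrix.fromBlocks_mulVec,
        Sum.elim_comp_inr, Sum.elim_comp_inl, Sum.elim_comp_inr, Matrix.mulVec_zero, add_zero] at hv
      exact hv.trans (Matrix.zero_mulVec _).symm
  let B : Fin (p + 1) → Matrix (Fin m₁ ⊕ Fin m₂) (Fin m₁ ⊕ Fin m₂) ℂ :=
    Fin.snoc (fun j => (g j : Matrix (Fin m₁ ⊕ Fin m₂) (Fin m₁ ⊕ Fin m₂) ℂ) * E j *
      (↑(g j)⁻¹ : Matrix (Fin m₁ ⊕ Fin m₂) (Fin m₁ ⊕ Fin m₂) ℂ)) L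
  have hBl : B (Fin.last p) = L :=
    Fin.snoc_last (α := fun _ => Matrix (Fin m₁ ⊕ Fin m₂) (Fin m₁ ⊕ Fin m₂) ℂ) _ _
  have hBc : ∀ j : Fin p, B j.castSucc =
      (g j : Matrix (Fin m₁ ⊕ Fin m₂) (Fin m₁ ⊕ Fin m₂) ℂ) * E j *
        (↑(g j)⁻¹ : Matrix (Fin m₁ ⊕ Fin m₂) (Fin m₁ ⊕ Fin m₂) ℂ) := fun j =>
    Fin.snoc_castSucc (α := fun _ => Matrix (Fin m₁ ⊕ Fin m₂) (Fin m₁ ⊕ Fin m₂) ℂ) _ _ _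
  refine ⟨B, ?_, fun j => ?_, fun U hU => ?_⟩
  · rw [Fin.sum_univ_castSucc, hBl]
    simp only [hBc]
    rw [hg, hEsum, neg_add_cancel]
  · induction j using Fin.lastCases with
    | cast j =>
      obtain ⟨u, hu⟩ := fromBlocks_conj_eq (A1 j.castSucc) (A2 j.castSucc) (Y j)
      refine ⟨g j * u, ?_⟩
      have hEj : E j = _ := hu
      rw [hBc, hEj, _root_.mul_inv_rev, Units.val_mul, Units.val_mul]
      simp only [Matrix.mul_assoc]
    | last => exact ⟨1, by rw [hBl, inv_one, Units.val_one, Matrix.one_mul, Matrix.mul_one]⟩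
  · refine hgU U (hBl ▸ hU (Fin.last p)) fun j => ?_
    have := hU j.castSucc
    rwa [hBc] at this
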